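/- arXiv:1006.0122 — 2 statements merged into one kernel-verified Lean document; each statement's English description precedes it below -/
import Mathlib

section
/- For 1 ≤ α ≤ 2 and all u in the Schwartz class on ℝ, one has ∫ (−|D|^α u)(x ∂_x u) dx = −((α−1)/2) ∫ ||D|^{α/2} u|² dx. -/
open MeasureTheory Complex ComplexConjugate

noncomputable section

/-- Japanese bracket `⟨x⟩ = (1+x²)^{1/2}`. -/
def jap (x : ℝ) : ℝ := Real.sqrt (1 + x ^ 2)

/-- Fourier transform with the convention `û(ξ) = ∫ e^{-ixξ} u(x) dx`. -/
def FT (u : ℝ → ℂ) (ξ : ℝ) : ℂ := ∫ x : ℝ, Complex.exp (-(Complex.I * (x : ℂ) * (ξ : ℂ))) * u x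

/-- Inverse Fourier transform `(1/2π) ∫ e^{ixξ} v(ξ) dξ`. -/
def FTinv (v : ℝ → ℂ) (x : ℝ) : ℂ :=
  ((2 * Real.pi)⁻¹ : ℝ) • ∫ ξ : ℝ, Complex.exp (Complex.I * (x : ℂ) * (ξ : ℂ)) * v ξ

/-- The Fourier multiplier `|D|^α` with symbol `|ξ|^α`. -/
def fracD (α : ℝ) (u : ℝ → ℂ) : ℝ → ℂ :=
  FTinv (fun ξ => ((|ξ| ^ α : ℝ) : ℂ) * FT u ξ)

end

open FourierTransform SchwartzMap
open scoped ContDiff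

lemma FT_eq_fourier (u : ℝ → ℂ) (ξ : ℝ) : FT u ξ = 𝓕 u (ξ / (2 * Real.pi)) := by
  rw [Real.fourier_real_eq_integral_exp_smul, FT]
  refine integral_congr_ae (.of_forall fun x => ?_)
  have hπ : (Real.pi : ℂ) ≠ 0 := by exact_mod_cast Real.pi_ne_zero
  simp only [smul_eq_mul]
  congr 2
  push_cast
  field_simp

/-- `|D|^a` in terms of Mathlib's Fourier transform. -/
lemma fracD_eq_fourierInv (a : ℝ) (u : ℝ → ℂ) (x : ℝ) :
    fracD a u x = (((2 * Real.pi) ^ a : ℝ) : ℂ) *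
      𝓕⁻ (fun η : ℝ => ((|η| ^ a : ℝ) : ℂ) * 𝓕 u η) x := by
  have hπ : 0 < 2 * Real.pi := by positivity
  have hsub := Measure.integral_comp_mul_left (fun ξ : ℝ =>
    Complex.exp (Complex.I * (x : ℂ) * (ξ : ℂ)) * (((|ξ| ^ a : ℝ) : ℂ) * FT u ξ)) (2 * Real.pi)
  rw [abs_of_pos (inv_pos.2 hπ)] at hsub
  rw [fracD, FTinv, ← hsub, Real.fourierInv_eq', ← integral_const_mul]
  refine integral_congr_ae (.of_forall fun η => ?_)
  simp only [FT_eq_fourier, smul_eq_mul, mul_div_cancel_left₀ _ hπ.ne', abs_mul, abs_of_pos hπ,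
    Real.mul_rpow hπ.le (abs_nonneg η), RCLike.inner_apply, conj_trivial]
  push_cast
  rw [show Complex.I * (x : ℂ) * (2 * Real.pi * η) = 2 * Real.pi * (x * η) * Complex.I by ring]
  ring

lemma continuous_abs_rpow {a : ℝ} (ha : 0 ≤ a) : Continuous fun η : ℝ => |η| ^ a :=
  continuous_abs.rpow_const fun _ => Or.inr ha

lemma integrable_abs_rpow_mul {a : ℝ} (ha : 0 ≤ a) (V : 𝓢(ℝ, ℂ)) :
    Integrable fun η : ℝ => ((|η| ^ a : ℝ) : ℂ) * V η := by
  obtain ⟨k, hk⟩ := exists_nat_ge a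
  refine (V.integrable.norm.add (V.integrable_pow_mul volume k)).mono'
    ((Complex.continuous_ofReal.comp (continuous_abs_rpow ha)).mul
      V.continuous).aestronglyMeasurable (.of_forall fun η => ?_)
  have hle : |η| ^ a ≤ 1 + |η| ^ k := by
    rcases le_total |η| 1 with h | h
    · exact (Real.rpow_le_one (abs_nonneg η) h ha).trans (by simp)
    · have := Real.rpow_le_rpow_of_exponent_le h hk
      rw [Real.rpow_natCast] at this
      linarith
  have hn : 0 ≤ |η| ^ a := by positivity
  simp only [norm_mul, Complex.norm_real, Real.norm_eq_abs, abs_of_nonneg hn, Pi.add_apply]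
  nlinarith [norm_nonneg (V η)]

lemma memLp_two_abs_rpow_mul {a : ℝ} (ha : 0 ≤ a) (V : 𝓢(ℝ, ℂ)) :
    MemLp (fun η : ℝ => ((|η| ^ a : ℝ) : ℂ) * V η) 2 := by
  have hc := (Complex.continuous_ofReal.comp (continuous_abs_rpow ha)).mul V.continuous
  refine (memLp_two_iff_integrable_sq_norm hc.aestronglyMeasurable).2 ?_
  have h := integrable_abs_rpow_mul (a := 2 * a) (by positivity)
    (SchwartzMap.pairing (ContinuousLinearMap.mul ℂ ℂ) V V)
  refine h.norm.congr (.of_forall fun η => ?_)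
  have hn : 0 ≤ |η| ^ a := by positivity
  simp only [mul_comm 2 a, Real.rpow_mul (abs_nonneg η), Real.rpow_two, pairing_apply_apply,
    ContinuousLinearMap.mul_apply', Pi.mul_apply, Function.comp_apply, norm_mul, Complex.norm_real,
    norm_pow, Real.norm_of_nonneg hn]
  ring

/-- Plancherel's theorem for the Fourier integral of functions in `L¹ ∩ L²`. -/
lemma integral_norm_sq_fourierInv {w : ℝ → ℂ} (h1 : Integrable w) (h2 : MemLp w 2) :
    ∫ x, ‖𝓕⁻ w x‖ ^ 2 = ∫ x, ‖w x‖ ^ 2 := by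
  have norm_sq : ∀ f : Lp ℂ 2 (volume : Measure ℝ), ∫ x, ‖f x‖ ^ 2 = ‖f‖ ^ 2 := fun f => by
    apply Complex.ofReal_injective
    have h := inner_self_eq_norm_sq_to_K (𝕜 := ℂ) f
    rw [L2.inner_def] at h
    simp only [inner_self_eq_norm_sq_to_K] at h
    rw [← integral_complex_ofReal]
    simpa using h
  have hae : (𝓕 (h2.toLp w) : Lp ℂ 2 (volume : Measure ℝ)) =ᵐ[volume] 𝓕 w := by
    have hcont : Continuous (𝓕 w) :=
      VectorFourier.fourierIntegral_continuous Real.continuous_fourierChar continuous_inner h1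
    refine ae_eq_of_integral_contDiff_smul_eq ((Lp.memLp _).locallyIntegrable one_le_two)
      hcont.locallyIntegrable fun g hg hgs => ?_
    have hg₁ : HasCompactSupport (Complex.ofRealCLM ∘ g) := hgs.comp_left rfl
    have hg₂ : ContDiff ℝ ∞ (Complex.ofRealCLM ∘ g) := by fun_prop
    let G : 𝓢(ℝ, ℂ) := hg₁.toSchwartzMap hg₂
    have e := congrArg (fun T => T G) (Lp.fourier_toTemperedDistribution_eq (h2.toLp w))
    simp only [TemperedDistribution.fourier_apply, Lp.toTemperedDistribution_apply] at e
    have flip : ∫ x, 𝓕 (G : ℝ → ℂ) x • w x = ∫ x, G x • 𝓕 w x := by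
      simpa using! VectorFourier.integral_fourierIntegral_smul_eq_flip (L := innerₗ ℝ)
        Real.continuous_fourierChar continuous_inner G.integrable h1
    calc ∫ x, g x • (𝓕 (h2.toLp w) : Lp ℂ 2 (volume : Measure ℝ)) x
        = ∫ x, G x • (𝓕 (h2.toLp w) : Lp ℂ 2 (volume : Measure ℝ)) x := by
          simp [G]
      _ = ∫ x, 𝓕 (G : ℝ → ℂ) x • w x := by
          rw [← e]
          refine integral_congr_ae ?_
          filter_upwards [h2.coeFn_toLp] with x hx
          rw [hx, SchwartzMap.fourier_coe]
      _ = ∫ x, g x • 𝓕 w x := by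
          rw [flip]
          simp [G]
  calc ∫ x, ‖𝓕⁻ w x‖ ^ 2 = ∫ x, ‖𝓕 w x‖ ^ 2 := by
        simp only [Real.fourierInv_eq_fourier_neg]
        exact integral_neg_eq_self (fun x => ‖𝓕 w x‖ ^ 2) volume
    _ = ∫ x, ‖(𝓕 (h2.toLp w) : Lp ℂ 2 (volume : Measure ℝ)) x‖ ^ 2 := by
        refine integral_congr_ae ?_
        filter_upwards [hae] with x hx
        rw [hx]
    _ = ∫ x, ‖h2.toLp w x‖ ^ 2 := by rw [norm_sq, norm_sq, Lp.norm_fourier_eq]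
    _ = ∫ x, ‖w x‖ ^ 2 := by
        refine integral_congr_ae ?_
        filter_upwards [h2.coeFn_toLp] with x hx
        rw [hx]

lemma hasDerivAt_mul_abs_rpow {a : ℝ} (ha : 0 < a) (x : ℝ) :
    HasDerivAt (fun x : ℝ => x * |x| ^ a) ((a + 1) * |x| ^ a) x := by
  rcases eq_or_ne x 0 with rfl | hx
  · rw [hasDerivAt_iff_tendsto_slope]
    have h := ((continuous_abs_rpow ha.le).tendsto 0).mono_left
      (nhdsWithin_le_nhds (s := {(0 : ℝ)}ᶜ))
    simp only [abs_zero, Real.zero_rpow ha.ne', mul_zero] at h ⊢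
    refine h.congr' ?_
    filter_upwards [self_mem_nhdsWithin] with y hy
    have : y ≠ 0 := hy
    simp [slope_def_field, this]
  · have h := (hasDerivAt_id x).mul ((hasDerivAt_abs hx).rpow_const (p := a)
      (Or.inl (abs_ne_zero.2 hx)))
    refine h.congr_deriv ?_
    have hx' : |x| ^ a = |x| ^ (a - 1) * |x| := by
      rw [← Real.rpow_add_one (abs_ne_zero.2 hx), sub_add_cancel]
    have hs : x * (SignType.sign x : ℝ) = |x| := by simp
    simp only [id, one_mul]
    rw [hx']
    linear_combination (a * |x| ^ (a - 1)) * hs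

lemma integral_mul_abs_rpow_mul_deriv {a : ℝ} (ha : 0 < a) (h : 𝓢(ℝ, ℂ)) :
    ∫ x : ℝ, ((|x| ^ a : ℝ) : ℂ) * (x * deriv h x) =
      -(a + 1) * ∫ x : ℝ, ((|x| ^ a : ℝ) : ℂ) * h x := by
  have hint : Integrable fun x : ℝ => ((|x| ^ a : ℝ) : ℂ) * h x := integrable_abs_rpow_mul ha.le h
  have hx : (fun x : ℝ => (x : ℂ)).HasTemperateGrowth := Complex.ofRealCLM.hasTemperateGrowth
  have hint' : Integrable fun x : ℝ => ((|x| ^ a : ℝ) : ℂ) * (x * deriv h x) := by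
    refine (integrable_abs_rpow_mul ha.le
      (SchwartzMap.smulLeftCLM ℂ (fun x : ℝ => (x : ℂ)) (SchwartzMap.derivCLM ℂ ℂ h))).congr
      (.of_forall fun x => ?_)
    simp [SchwartzMap.smulLeftCLM_apply_apply hx]
  have hint'' : Integrable fun x : ℝ => ((|x| ^ a : ℝ) : ℂ) * (x * h x) := by
    refine (integrable_abs_rpow_mul ha.le
      (SchwartzMap.smulLeftCLM ℂ (fun x : ℝ => (x : ℂ)) h)).congr (.of_forall fun x => ?_)
    simp [SchwartzMap.smulLeftCLM_apply_apply hx]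
  have key := integral_eq_zero_of_hasDerivAt_of_integrable
    (f := fun x : ℝ => ((|x| ^ a : ℝ) : ℂ) * (x * h x))
    (f' := fun x : ℝ => (a + 1) * (((|x| ^ a : ℝ) : ℂ) * h x) +
      ((|x| ^ a : ℝ) : ℂ) * (x * deriv h x)) (fun x => ?_) ((hint.const_mul _).add hint') hint''
  · rw [integral_add (hint.const_mul _) hint', integral_const_mul] at key
    linear_combination key
  · have hd := (hasDerivAt_mul_abs_rpow ha x).ofReal_comp.mul (h.hasDerivAt x)
    have hfun : (fun x : ℝ => ((|x| ^ a : ℝ) : ℂ) * (x * h x)) =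
        (fun y : ℝ => ((y * |y| ^ a : ℝ) : ℂ)) * h := by
      ext y
      simp only [Pi.mul_apply, Complex.ofReal_mul]
      ring
    rw [hfun]
    exact hd.congr_deriv (by push_cast; ring)

/-- The Fourier transform of `x ∂ₓ f`. -/
lemma fourier_mul_deriv (f : 𝓢(ℝ, ℂ)) (ξ : ℝ) :
    𝓕 (fun x : ℝ => (x : ℂ) * deriv f x) ξ =
      -(𝓕 (f : ℝ → ℂ) ξ + ξ * deriv (𝓕 (f : ℝ → ℂ)) ξ) := by
  have hπ : (2 * Real.pi * Complex.I : ℂ) ≠ 0 := Complex.two_pi_I_ne_zero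
  have hx : (fun x : ℝ => (x : ℂ)).HasTemperateGrowth := Complex.ofRealCLM.hasTemperateGrowth
  have hint : Integrable fun x : ℝ => x • deriv f x := by
    refine (SchwartzMap.smulLeftCLM ℂ (fun x : ℝ => (x : ℂ))
      (SchwartzMap.derivCLM ℂ ℂ f)).integrable.congr (.of_forall fun x => ?_)
    simp [SchwartzMap.smulLeftCLM_apply_apply hx]
  have hdi : Integrable (deriv f) := (SchwartzMap.derivCLM ℂ ℂ f).integrable
  have h1 := Real.hasDerivAt_fourier hdi hint ξ
  rw [Real.fourier_deriv f.integrable f.differentiable hdi] at h1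
  have h2 : HasDerivAt (fun x : ℝ => (2 * Real.pi * Complex.I * x) • 𝓕 (f : ℝ → ℂ) x)
      (2 * Real.pi * Complex.I * (𝓕 (f : ℝ → ℂ) ξ + ξ * deriv (𝓕 (f : ℝ → ℂ)) ξ)) ξ := by
    have := ((hasDerivAt_id ξ).ofReal_comp.mul ((𝓕 f).hasDerivAt ξ)).const_mul
      (2 * Real.pi * Complex.I)
    have hfun : (fun x : ℝ => (2 * Real.pi * Complex.I * x) • 𝓕 (f : ℝ → ℂ) x) =
        fun x : ℝ => 2 * Real.pi * Complex.I * (x * 𝓕 (f : ℝ → ℂ) x) := by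
      ext x
      simp only [smul_eq_mul, mul_assoc]
    rw [hfun]
    exact this.congr_deriv (by simp [SchwartzMap.fourier_coe])
  have h3 := h1.unique h2
  have h4 : 𝓕 (fun x : ℝ => (-2 * Real.pi * Complex.I * x) • deriv f x) ξ =
      -(2 * Real.pi * Complex.I) * 𝓕 (fun x : ℝ => (x : ℂ) * deriv f x) ξ := by
    rw [Real.fourier_eq, Real.fourier_eq, ← integral_const_mul]
    refine integral_congr_ae (.of_forall fun x => ?_)
    simp only [Circle.smul_def, smul_eq_mul]
    ring
  rw [h4] at h3
  apply mul_left_cancel₀ hπ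
  linear_combination -h3

lemma integral_fourierInv_mul_eq {w g : ℝ → ℂ} (hw : Integrable w) (hg : Integrable g) :
    ∫ x, 𝓕⁻ w x * g x = ∫ ξ, w ξ * 𝓕⁻ g ξ := by
  have hflip : (-innerₗ ℝ : ℝ →ₗ[ℝ] ℝ →ₗ[ℝ] ℝ).flip = -innerₗ ℝ := by
    ext
    simp
  have h := VectorFourier.integral_fourierIntegral_smul_eq_flip (μ := volume) (ν := volume)
    (L := (-innerₗ ℝ : ℝ →ₗ[ℝ] ℝ →ₗ[ℝ] ℝ))
    Real.continuous_fourierChar continuous_inner.neg hw hg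
  rw [hflip] at h
  exact h

/-- The identity `⟨|D|^a f, x ∂ₓ f⟩ = ((a - 1) / 2) ⟨|D|^a f, f⟩` on the Fourier side. -/
lemma integral_fourierInv_abs_rpow_mul {a : ℝ} (ha : 0 < a) (f : 𝓢(ℝ, ℂ)) :
    ∫ x : ℝ, 𝓕⁻ (fun η : ℝ => ((|η| ^ a : ℝ) : ℂ) * 𝓕 (f : ℝ → ℂ) η) x * (x * deriv f x) =
      (a - 1) / 2 * ∫ η : ℝ, ((|η| ^ a : ℝ) : ℂ) *
        (𝓕 (f : ℝ → ℂ) η * 𝓕 (f : ℝ → ℂ) (-η)) := by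
  have hx : (fun x : ℝ => (x : ℂ)).HasTemperateGrowth := Complex.ofRealCLM.hasTemperateGrowth
  let M := ContinuousLinearMap.mul ℂ ℂ
  let V : 𝓢(ℝ, ℂ) := 𝓕 f
  let R : 𝓢(ℝ, ℂ) := 𝓕⁻ f
  have hR : ∀ ξ, R ξ = V (-ξ) := fun ξ => by
    simp only [R, V, SchwartzMap.fourierInv_coe, SchwartzMap.fourier_coe,
      Real.fourierInv_eq_fourier_neg]
  have hR' : ∀ ξ, deriv R ξ = -deriv V (-ξ) := fun ξ => by
    rw [show (R : ℝ → ℂ) = fun ξ => V (-ξ) from funext hR, deriv_comp_neg]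
  have hg : Integrable fun x : ℝ => (x : ℂ) * deriv f x := by
    refine (SchwartzMap.smulLeftCLM ℂ (fun x : ℝ => (x : ℂ))
      (SchwartzMap.derivCLM ℂ ℂ f)).integrable.congr (.of_forall fun x => ?_)
    simp [SchwartzMap.smulLeftCLM_apply_apply hx]
  have hJ : Integrable fun ξ : ℝ => ((|ξ| ^ a : ℝ) : ℂ) * (V ξ * V (-ξ)) := by
    refine (integrable_abs_rpow_mul ha.le (SchwartzMap.pairing M V R)).congr
      (.of_forall fun ξ => ?_)
    simp [M, hR]
  have hK : Integrable fun ξ : ℝ => ((|ξ| ^ a : ℝ) : ℂ) * (ξ * (V ξ * deriv V (-ξ))) := by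
    refine (integrable_abs_rpow_mul ha.le (SchwartzMap.smulLeftCLM ℂ (fun x : ℝ => (x : ℂ))
      (SchwartzMap.pairing M V (SchwartzMap.derivCLM ℂ ℂ R)))).neg.congr (.of_forall fun ξ => ?_)
    simp [M, hR', SchwartzMap.smulLeftCLM_apply_apply hx]
  have hrefl : ∫ ξ : ℝ, ((|ξ| ^ a : ℝ) : ℂ) * (ξ * (deriv V ξ * V (-ξ))) =
      -∫ ξ : ℝ, ((|ξ| ^ a : ℝ) : ℂ) * (ξ * (V ξ * deriv V (-ξ))) := by
    rw [← integral_neg_eq_self, ← integral_neg]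
    refine integral_congr_ae (.of_forall fun ξ => ?_)
    simp only [abs_neg, neg_neg, Complex.ofReal_neg]
    ring
  have hK' : Integrable fun ξ : ℝ => ((|ξ| ^ a : ℝ) : ℂ) * (ξ * (deriv V ξ * V (-ξ))) := by
    refine (integrable_abs_rpow_mul ha.le (SchwartzMap.smulLeftCLM ℂ (fun x : ℝ => (x : ℂ))
      (SchwartzMap.pairing M (SchwartzMap.derivCLM ℂ ℂ V) R))).congr (.of_forall fun ξ => ?_)
    simp [M, hR, SchwartzMap.smulLeftCLM_apply_apply hx]
  have hparts : (∫ ξ : ℝ, ((|ξ| ^ a : ℝ) : ℂ) * (ξ * (deriv V ξ * V (-ξ)))) -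
      ∫ ξ : ℝ, ((|ξ| ^ a : ℝ) : ℂ) * (ξ * (V ξ * deriv V (-ξ))) =
      -(a + 1) * ∫ ξ : ℝ, ((|ξ| ^ a : ℝ) : ℂ) * (V ξ * V (-ξ)) := by
    have h := integral_mul_abs_rpow_mul_deriv ha (SchwartzMap.pairing M V R)
    have hd : ∀ ξ, deriv (SchwartzMap.pairing M V R) ξ =
        deriv V ξ * V (-ξ) - V ξ * deriv V (-ξ) := fun ξ => by
      have hfun : (SchwartzMap.pairing M V R : ℝ → ℂ) = V * R := by
        ext
        simp [M]
      rw [hfun, ((V.hasDerivAt ξ).mul (R.hasDerivAt ξ)).deriv, hR, hR']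
      ring
    rw [← integral_sub hK' hK]
    simp only [hd, SchwartzMap.pairing_apply_apply, hR, M, ContinuousLinearMap.mul_apply'] at h
    rw [← h]
    refine integral_congr_ae (.of_forall fun ξ => ?_)
    simp only
    ring
  have hmain : ∫ x : ℝ, 𝓕⁻ (fun η : ℝ => ((|η| ^ a : ℝ) : ℂ) * V η) x * (x * deriv f x) =
      (∫ ξ : ℝ, ((|ξ| ^ a : ℝ) : ℂ) * (ξ * (V ξ * deriv V (-ξ)))) -
      ∫ ξ : ℝ, ((|ξ| ^ a : ℝ) : ℂ) * (V ξ * V (-ξ)) := by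
    rw [integral_fourierInv_mul_eq (integrable_abs_rpow_mul ha.le V) hg, ← integral_sub hK hJ]
    refine integral_congr_ae (.of_forall fun ξ => ?_)
    simp only [Real.fourierInv_eq_fourier_neg, fourier_mul_deriv, V, SchwartzMap.fourier_coe,
      Complex.ofReal_neg]
    ring
  change ∫ x : ℝ, 𝓕⁻ (fun η : ℝ => ((|η| ^ a : ℝ) : ℂ) * V η) x * (x * deriv f x) =
    (a - 1) / 2 * ∫ η : ℝ, ((|η| ^ a : ℝ) : ℂ) * (V η * V (-η))
  rw [hmain]
  linear_combination (hrefl - hparts) / 2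

lemma fourier_neg_of_real (u : ℝ → ℝ) (ξ : ℝ) :
    𝓕 (fun x => (u x : ℂ)) (-ξ) = conj (𝓕 (fun x => (u x : ℂ)) ξ) := by
  rw [Real.fourier_real_eq_integral_exp_smul, Real.fourier_real_eq_integral_exp_smul,
    ← integral_conj]
  refine integral_congr_ae (.of_forall fun x => ?_)
  simp only [smul_eq_mul, map_mul, Complex.conj_ofReal, ← Complex.exp_conj, Complex.conj_I]
  push_cast
  congr 2
  ring

/-- for Schwartz `u`, `∫(−|D|^α u)(x ∂ₓu) dx = −((α−1)/2)∫||D|^{α/2}u|² dx`. -/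
theorem stmt_1 (α : ℝ) (hα1 : 1 ≤ α) (hα2 : α ≤ 2) (u : SchwartzMap ℝ ℝ) :
    (∫ x : ℝ, (-(fracD α (fun y => (u y : ℂ)) x)) *
        ((x * deriv (fun y : ℝ => (u y : ℝ)) x : ℝ) : ℂ)) =
      -(((α - 1) / 2 : ℝ) : ℂ) *
        ((∫ x : ℝ, ‖fracD (α / 2) (fun y => (u y : ℂ)) x‖ ^ 2 : ℝ) : ℂ) := by
  let f : SchwartzMap ℝ ℂ := u.postcompCLM (𝕜 := ℝ) Complex.ofRealCLM
  have hf : (f : ℝ → ℂ) = fun y => (u y : ℂ) := by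
    ext
    simp [f]
  have hf' : ∀ x, deriv f x = ((deriv (fun y : ℝ => u y) x : ℝ) : ℂ) := fun x => by
    rw [hf]
    exact (u.hasDerivAt x).ofReal_comp.deriv
  have hc : ∀ a : ℝ, 0 ≤ (2 * Real.pi) ^ a := fun a => by positivity
  have hsq : (((2 * Real.pi) ^ (α / 2) : ℝ) : ℂ) ^ 2 = (((2 * Real.pi) ^ α : ℝ) : ℂ) := by
    rw [← Complex.ofReal_pow, ← Real.rpow_natCast, ← Real.rpow_mul (by positivity)]
    norm_num
  have hleft := integral_fourierInv_abs_rpow_mul (a := α) (by linarith) f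
  have hright : ∫ x : ℝ, ‖fracD (α / 2) (fun y => (u y : ℂ)) x‖ ^ 2 =
      ((2 * Real.pi) ^ (α / 2)) ^ 2 *
        ∫ η : ℝ, ‖((|η| ^ (α / 2) : ℝ) : ℂ) * 𝓕 (f : ℝ → ℂ) η‖ ^ 2 := by
    have hplancherel := integral_norm_sq_fourierInv
      (integrable_abs_rpow_mul (a := α / 2) (by linarith) (𝓕 f))
      (memLp_two_abs_rpow_mul (by linarith) (𝓕 f))
    simp only [SchwartzMap.fourier_coe] at hplancherel
    rw [← hplancherel, ← integral_const_mul]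
    refine integral_congr_ae (.of_forall fun x => ?_)
    simp only [fracD_eq_fourierInv, norm_mul, Complex.norm_real, Real.norm_of_nonneg (hc _),
      mul_pow, ← hf]
  have hJ : ∫ η : ℝ, ((|η| ^ α : ℝ) : ℂ) * (𝓕 (f : ℝ → ℂ) η * 𝓕 (f : ℝ → ℂ) (-η)) =
      ((∫ η : ℝ, ‖((|η| ^ (α / 2) : ℝ) : ℂ) * 𝓕 (f : ℝ → ℂ) η‖ ^ 2 : ℝ) : ℂ) := by
    rw [← integral_complex_ofReal]
    refine integral_congr_ae (.of_forall fun η => ?_)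
    have hn : 0 ≤ |η| ^ (α / 2) := by positivity
    have hpow : |η| ^ α = (|η| ^ (α / 2)) ^ 2 := by
      rw [← Real.rpow_natCast, ← Real.rpow_mul (abs_nonneg η)]
      norm_num
    simp only [hf, fourier_neg_of_real, Complex.mul_conj', hpow, norm_mul, Complex.norm_real,
      Real.norm_of_nonneg hn]
    push_cast
    ring
  have hint : ∫ x : ℝ, (-(fracD α (fun y => (u y : ℂ)) x)) *
        ((x * deriv (fun y : ℝ => (u y : ℝ)) x : ℝ) : ℂ) =
      -(((2 * Real.pi) ^ α : ℝ) : ℂ) * ∫ x : ℝ,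
        𝓕⁻ (fun η : ℝ => ((|η| ^ α : ℝ) : ℂ) * 𝓕 (f : ℝ → ℂ) η) x * (x * deriv f x) := by
    rw [← integral_const_mul]
    refine integral_congr_ae (.of_forall fun x => ?_)
    simp only [fracD_eq_fourierInv, ← hf, hf', Complex.ofReal_mul]
    ring
  rw [hint, hleft, hJ, hright, Complex.ofReal_mul, Complex.ofReal_pow, hsq]
  push_cast
  ring
end

section
/- Let r > 1/2 and let h(ξ) = ∫_ℝ e^{−ixξ} ⟨x⟩^{−2r} dx. Then h is infinitely differentiable on ℝ \ {0}, and for every β ∈ ℕ and q > 0 there exists a constant C_{β,q} > 0 such that |∂_ξ^β h(ξ)| ≤ C_{β,q} |ξ|^{−β} ⟨ξ⟩^{−q} for all ξ ≠ 0. -/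
open MeasureTheory Complex ComplexConjugate

open Set

noncomputable section

/-- The Bessel-type kernel `∫₀^∞ t^{s-1} e^{-t-ξ²/(4t)} dt`. -/
def besselKernel (s ξ : ℝ) : ℝ :=
  ∫ t in Ioi (0 : ℝ), t ^ (s - 1) * Real.exp (-t - ξ ^ 2 / (4 * t))

/-- The function `ξ ↦ ξ^{2j-n} ∫₀^∞ t^{s-j-1} e^{-t-ξ²/(4t)} dt`. -/
def besselTerm (s : ℝ) (n j : ℕ) (ξ : ℝ) : ℂ :=
  ((ξ ^ (2 * (j : ℤ) - n) * besselKernel (s - j) ξ : ℝ) : ℂ)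

/-- The span of the functions `besselTerm s n j`, `j ∈ ℕ`. -/
def besselSpan (s : ℝ) (n : ℕ) : Submodule ℂ (ℝ → ℂ) :=
  Submodule.span ℂ (range (besselTerm s n))

end

theorem pow_mul_exp_neg_le_factorial {x : ℝ} (hx : 0 ≤ x) (n : ℕ) :
    x ^ n * Real.exp (-x) ≤ n.factorial := by
  have h := Real.pow_div_factorial_le_exp x hx n
  rw [div_le_iff₀ (by positivity)] at h
  rw [Real.exp_neg, ← div_eq_mul_inv, div_le_iff₀ (Real.exp_pos x)]
  linarith

theorem integrableOn_rpow_mul_exp_neg_mul {s b : ℝ} (hs : -1 < s) (hb : 0 < b) :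
    IntegrableOn (fun t : ℝ => t ^ s * Real.exp (-b * t)) (Ioi 0) := by
  simpa using integrableOn_rpow_mul_exp_neg_mul_rpow hs one_pos hb

theorem aestronglyMeasurable_rpow_mul_exp_sub_div (s c : ℝ) :
    AEStronglyMeasurable (fun t : ℝ => t ^ s * Real.exp (-t - c / t)) (volume.restrict (Ioi 0)) :=
  (by fun_prop : Measurable fun t : ℝ => t ^ s * Real.exp (-t - c / t)).aestronglyMeasurable

theorem integrableOn_rpow_mul_exp_sub_div (s : ℝ) {c : ℝ} (hc : 0 < c) :
    IntegrableOn (fun t : ℝ => t ^ s * Real.exp (-t - c / t)) (Ioi 0) := by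
  obtain ⟨N, hN⟩ := exists_nat_gt (-1 - s)
  have hint := (integrableOn_rpow_mul_exp_neg_mul (s := s + N) (by linarith) one_pos).const_mul
    (N.factorial / c ^ N)
  refine Integrable.mono' hint (aestronglyMeasurable_rpow_mul_exp_sub_div s c) ?_
  filter_upwards [ae_restrict_mem measurableSet_Ioi] with t ht
  have ht : 0 < t := ht
  have h := pow_mul_exp_neg_le_factorial (div_pos hc ht).le N
  have h2 : Real.exp (-(c / t)) ≤ N.factorial / c ^ N * t ^ N := by
    rw [div_pow, div_mul_eq_mul_div, div_le_iff₀ (by positivity)] at h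
    rw [div_mul_eq_mul_div, le_div_iff₀ (by positivity)]
    linarith
  rw [Real.norm_of_nonneg (by positivity), sub_eq_add_neg, Real.exp_add, Real.rpow_add ht,
    Real.rpow_natCast, neg_one_mul]
  calc t ^ s * (Real.exp (-t) * Real.exp (-(c / t)))
      ≤ t ^ s * (Real.exp (-t) * (N.factorial / c ^ N * t ^ N)) := by gcongr
    _ = _ := by ring

theorem hasDerivAt_besselKernel (s : ℝ) {ξ : ℝ} (hξ : ξ ≠ 0) :
    HasDerivAt (besselKernel s) (-(ξ / 2) * besselKernel (s - 1) ξ) ξ := by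
  have hpos : 0 < |ξ| := abs_pos.mpr hξ
  have hdiv : ∀ y t : ℝ, y ^ 2 / (4 * t) = y ^ 2 / 4 / t := fun y t => by rw [div_div]
  have key := hasDerivAt_integral_of_dominated_loc_of_deriv_le
    (μ := volume.restrict (Ioi (0 : ℝ))) (x₀ := ξ) (s := Metric.ball ξ (|ξ| / 2))
    (F := fun y t : ℝ => t ^ (s - 1) * Real.exp (-t - y ^ 2 / (4 * t)))
    (F' := fun y t : ℝ => -(y / 2) * (t ^ (s - 1 - 1) * Real.exp (-t - y ^ 2 / (4 * t))))
    (bound := fun t : ℝ => |ξ| * (t ^ (s - 1 - 1) * Real.exp (-t - (ξ ^ 2 / 16) / t)))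
    (Metric.ball_mem_nhds _ (by positivity)) ?_ ?_ ?_ ?_ ?_ ?_
  · have h := key.2
    rw [integral_const_mul] at h
    exact h
  · refine Filter.Eventually.of_forall fun y => ?_
    simp only [hdiv]
    exact aestronglyMeasurable_rpow_mul_exp_sub_div _ _
  · simp only [hdiv]
    exact integrableOn_rpow_mul_exp_sub_div _ (by positivity)
  · simp only [hdiv]
    exact (aestronglyMeasurable_rpow_mul_exp_sub_div _ _).const_mul _
  · filter_upwards [ae_restrict_mem measurableSet_Ioi] with t ht y hy
    have ht : 0 < t := ht
    rw [Metric.mem_ball, Real.dist_eq] at hy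
    have h1 : |y| ≤ 2 * |ξ| := by
      have := abs_sub_abs_le_abs_sub y ξ
      linarith
    have h2 : |ξ| / 2 ≤ |y| := by
      have := abs_sub_abs_le_abs_sub ξ y
      rw [abs_sub_comm] at this
      linarith
    have h3 : ξ ^ 2 / 16 ≤ y ^ 2 / 4 := by
      rw [← sq_abs ξ, ← sq_abs y]
      nlinarith
    have h4 : |y / 2| ≤ |ξ| := by
      rw [abs_div, abs_two]
      linarith
    rw [norm_mul, norm_neg, Real.norm_eq_abs, Real.norm_of_nonneg (by positivity), hdiv]
    gcongr
  · exact (integrableOn_rpow_mul_exp_sub_div _ (by positivity)).const_mul _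
  · filter_upwards [ae_restrict_mem measurableSet_Ioi] with t ht y _
    have ht : 0 < t := ht
    have h : HasDerivAt (fun y : ℝ => -t - y ^ 2 / (4 * t)) (-(2 * y / (4 * t))) y := by
      simpa using (((hasDerivAt_id y).pow 2).div_const (4 * t)).const_sub (-t)
    refine (h.exp.const_mul (t ^ (s - 1))).congr_deriv ?_
    rw [Real.rpow_sub_one ht.ne' (s - 1)]
    field_simp
    ring

theorem hasDerivAt_besselTerm (s : ℝ) (n j : ℕ) {ξ : ℝ} (hξ : ξ ≠ 0) :
    HasDerivAt (besselTerm s n j)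
      ((2 * (j : ℂ) - n) * besselTerm s (n + 1) j ξ - 1 / 2 * besselTerm s (n + 1) (j + 1) ξ) ξ := by
  have h := ((hasDerivAt_zpow (2 * (j : ℤ) - n) ξ (Or.inl hξ)).mul
    (hasDerivAt_besselKernel (s - j) hξ)).ofReal_comp
  refine h.congr_deriv ?_
  have e1 : 2 * (j : ℤ) - n - 1 = 2 * (j : ℤ) - (n + 1 : ℕ) := by push_cast; ring
  have e2 : 2 * ((j + 1 : ℕ) : ℤ) - (n + 1 : ℕ) = (2 * (j : ℤ) - n) + 1 := by push_cast; ring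
  have e3 : s - ((j + 1 : ℕ) : ℝ) = s - j - 1 := by push_cast; ring
  simp only [besselTerm, e2, e3, ← e1, zpow_add_one₀ hξ]
  push_cast
  ring

theorem exists_hasDerivAt_of_mem_besselSpan {s : ℝ} {n : ℕ} {f : ℝ → ℂ}
    (hf : f ∈ besselSpan s n) :
    ∃ g ∈ besselSpan s (n + 1), ∀ ξ : ℝ, ξ ≠ 0 → HasDerivAt f (g ξ) ξ := by
  induction hf using Submodule.span_induction with
  | mem f hf =>
    obtain ⟨j, rfl⟩ := hf
    refine ⟨(2 * (j : ℂ) - n) • besselTerm s (n + 1) j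
      - (1 / 2 : ℂ) • besselTerm s (n + 1) (j + 1), ?_,
      fun ξ hξ => hasDerivAt_besselTerm s n j hξ⟩
    exact Submodule.sub_mem _
      (Submodule.smul_mem _ _ (Submodule.subset_span (mem_range_self _)))
      (Submodule.smul_mem _ _ (Submodule.subset_span (mem_range_self _)))
  | zero => exact ⟨0, Submodule.zero_mem _, fun ξ _ => hasDerivAt_const ξ 0⟩
  | add f₁ f₂ _ _ h₁ h₂ =>
    obtain ⟨g₁, hg₁, hd₁⟩ := h₁
    obtain ⟨g₂, hg₂, hd₂⟩ := h₂
    exact ⟨g₁ + g₂, Submodule.add_mem _ hg₁ hg₂, fun ξ hξ => (hd₁ ξ hξ).add (hd₂ ξ hξ)⟩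
  | smul a f _ h =>
    obtain ⟨g, hg, hd⟩ := h
    exact ⟨a • g, Submodule.smul_mem _ a hg, fun ξ hξ => (hd ξ hξ).const_smul a⟩

theorem exists_iteratedDeriv_eqOn_besselSpan {s : ℝ} {h f : ℝ → ℂ} (hf : f ∈ besselSpan s 0)
    (hh : EqOn h f {ξ | ξ ≠ 0}) (n : ℕ) :
    ∃ g ∈ besselSpan s n, EqOn (iteratedDeriv n h) g {ξ | ξ ≠ 0} := by
  induction n with
  | zero => exact ⟨f, hf, by simpa using hh⟩
  | succ n ih =>
    obtain ⟨g, hg, heq⟩ := ih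
    obtain ⟨g', hg', hd⟩ := exists_hasDerivAt_of_mem_besselSpan hg
    refine ⟨g', hg', fun ξ hξ => ?_⟩
    rw [iteratedDeriv_succ,
      (heq.eventuallyEq_of_mem (isOpen_ne.mem_nhds hξ)).deriv_eq, (hd ξ hξ).deriv]

theorem contDiffOn_of_eqOn_besselSpan {s : ℝ} {h f : ℝ → ℂ} (hf : f ∈ besselSpan s 0)
    (hh : EqOn h f {ξ | ξ ≠ 0}) :
    ContDiffOn ℝ (⊤ : ℕ∞) h {ξ | ξ ≠ 0} := by
  refine contDiffOn_of_differentiableOn_deriv fun m _ => ?_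
  obtain ⟨g, hg, heq⟩ := exists_iteratedDeriv_eqOn_besselSpan hf hh m
  obtain ⟨g', -, hd⟩ := exists_hasDerivAt_of_mem_besselSpan hg
  have hopen : IsOpen {ξ : ℝ | ξ ≠ 0} := isOpen_ne
  exact DifferentiableOn.congr
    (fun ξ hξ => (hd ξ hξ).differentiableAt.differentiableWithinAt)
    fun ξ hξ => (iteratedDerivWithin_of_isOpen hopen hξ).trans (heq hξ)

theorem one_le_jap (ξ : ℝ) : 1 ≤ jap ξ :=
  Real.one_le_sqrt.mpr (by nlinarith [sq_nonneg ξ])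

theorem exists_exp_neg_half_abs_le_jap_rpow (q : ℝ) :
    ∃ C : ℝ, 0 < C ∧ ∀ ξ : ℝ, Real.exp (-(|ξ| / 2)) ≤ C * jap ξ ^ (-q) := by
  obtain ⟨N, hN⟩ := exists_nat_ge q
  refine ⟨N.factorial * 2 ^ N * Real.exp (1 / 2), by positivity, fun ξ => ?_⟩
  have h1 := one_le_jap ξ
  have h0 : 0 < jap ξ := by linarith
  have h2 : jap ξ ≤ 1 + |ξ| := by
    refine Real.sqrt_le_iff.mpr ⟨by positivity, ?_⟩
    nlinarith [sq_abs ξ, abs_nonneg ξ]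
  have h3 : jap ξ ^ q ≤ (1 + |ξ|) ^ N := by
    calc jap ξ ^ q ≤ jap ξ ^ (N : ℝ) := Real.rpow_le_rpow_of_exponent_le h1 hN
      _ = jap ξ ^ N := Real.rpow_natCast _ _
      _ ≤ _ := by gcongr
  have h4 := pow_mul_exp_neg_le_factorial (x := (1 + |ξ|) / 2) (by positivity) N
  rw [Real.rpow_neg h0.le, ← div_eq_mul_inv, le_div_iff₀ (by positivity)]
  have h5 : Real.exp (-(|ξ| / 2)) = Real.exp (1 / 2) * Real.exp (-((1 + |ξ|) / 2)) := by
    rw [← Real.exp_add]; ring_nf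
  calc Real.exp (-(|ξ| / 2)) * jap ξ ^ q
      ≤ Real.exp (-(|ξ| / 2)) * (1 + |ξ|) ^ N := by gcongr
    _ = 2 ^ N * Real.exp (1 / 2) * (((1 + |ξ|) / 2) ^ N * Real.exp (-((1 + |ξ|) / 2))) := by
      rw [h5, div_pow]; field_simp
    _ ≤ 2 ^ N * Real.exp (1 / 2) * N.factorial := by gcongr
    _ = _ := by ring

theorem exists_pow_mul_besselKernel_le {s : ℝ} (hs : 0 < s) (j : ℕ) :
    ∃ C : ℝ, 0 ≤ C ∧ ∀ ξ : ℝ, ξ ≠ 0 →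
      |ξ ^ (2 * j) * besselKernel (s - j) ξ| ≤ C * Real.exp (-(|ξ| / 2)) := by
  have hint := integrableOn_rpow_mul_exp_neg_mul (s := s - 1) (b := 1 / 2) (by linarith)
    (by norm_num)
  refine ⟨(8 ^ j * j.factorial) * ∫ t in Ioi (0 : ℝ), t ^ (s - 1) * Real.exp (-(1 / 2) * t),
    mul_nonneg (by positivity)
      (setIntegral_nonneg measurableSet_Ioi fun t (ht : 0 < t) => by positivity), fun ξ hξ => ?_⟩
  rw [besselKernel, ← integral_const_mul, mul_assoc, mul_comm (integral _ _), ← mul_assoc,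
    ← integral_const_mul, ← Real.norm_eq_abs]
  refine norm_integral_le_of_norm_le (hint.const_mul _) ?_
  filter_upwards [ae_restrict_mem measurableSet_Ioi] with t ht
  have ht : 0 < t := ht
  have h1 := pow_mul_exp_neg_le_factorial (x := ξ ^ 2 / (8 * t)) (by positivity) j
  have h2 : |ξ| / 2 ≤ t / 2 + ξ ^ 2 / (8 * t) := by
    rw [← sub_nonneg, ← sq_abs]
    have : t / 2 + |ξ| ^ 2 / (8 * t) - |ξ| / 2 = (2 * t - |ξ|) ^ 2 / (8 * t) := by
      field_simp; ring
    rw [this]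
    positivity
  have h3 : ξ ^ (2 * j) * t ^ (s - j - 1) = 8 ^ j * t ^ (s - 1) * (ξ ^ 2 / (8 * t)) ^ j := by
    rw [show s - j - 1 = s - 1 - j by ring, Real.rpow_sub ht, Real.rpow_natCast, div_pow, mul_pow,
      pow_mul]
    field_simp
  have h4 : Real.exp (-t - ξ ^ 2 / (4 * t)) = Real.exp (-(1 / 2) * t) *
      Real.exp (-(t / 2 + ξ ^ 2 / (8 * t))) * Real.exp (-(ξ ^ 2 / (8 * t))) := by
    rw [← Real.exp_add, ← Real.exp_add]
    congr 1
    field_simp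
    ring
  rw [← mul_assoc, h3, h4, Real.norm_of_nonneg (by positivity)]
  calc 8 ^ j * t ^ (s - 1) * (ξ ^ 2 / (8 * t)) ^ j * (Real.exp (-(1 / 2) * t) *
        Real.exp (-(t / 2 + ξ ^ 2 / (8 * t))) * Real.exp (-(ξ ^ 2 / (8 * t))))
      = 8 ^ j * t ^ (s - 1) * Real.exp (-(1 / 2) * t) * Real.exp (-(t / 2 + ξ ^ 2 / (8 * t))) *
        ((ξ ^ 2 / (8 * t)) ^ j * Real.exp (-(ξ ^ 2 / (8 * t)))) := by ring
    _ ≤ 8 ^ j * t ^ (s - 1) * Real.exp (-(1 / 2) * t) * Real.exp (-(|ξ| / 2)) *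
        j.factorial := by gcongr
    _ = _ := by ring

theorem exists_norm_le_of_mem_besselSpan {s : ℝ} (hs : 0 < s) {n : ℕ} {f : ℝ → ℂ}
    (hf : f ∈ besselSpan s n) :
    ∃ C : ℝ, 0 ≤ C ∧ ∀ ξ : ℝ, ξ ≠ 0 →
      ‖f ξ‖ ≤ C * (|ξ| ^ (-(n : ℝ)) * Real.exp (-(|ξ| / 2))) := by
  induction hf using Submodule.span_induction with
  | mem f hf =>
    obtain ⟨j, rfl⟩ := hf
    obtain ⟨C, hC, h⟩ := exists_pow_mul_besselKernel_le hs j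
    refine ⟨C, hC, fun ξ hξ => ?_⟩
    have e : ξ ^ (2 * (j : ℤ) - n) * besselKernel (s - j) ξ
        = (ξ ^ n)⁻¹ * (ξ ^ (2 * j) * besselKernel (s - j) ξ) := by
      rw [zpow_sub₀ hξ, zpow_natCast, show 2 * (j : ℤ) = ((2 * j : ℕ) : ℤ) by push_cast; ring,
        zpow_natCast]
      ring
    rw [besselTerm, Complex.norm_real, Real.norm_eq_abs, e, abs_mul, abs_inv, abs_pow,
      Real.rpow_neg (abs_nonneg ξ), Real.rpow_natCast]
    calc (|ξ| ^ n)⁻¹ * |ξ ^ (2 * j) * besselKernel (s - j) ξ|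
        ≤ (|ξ| ^ n)⁻¹ * (C * Real.exp (-(|ξ| / 2))) := by gcongr; exact h ξ hξ
      _ = _ := by ring
  | zero => exact ⟨0, le_rfl, fun ξ _ => by simp⟩
  | add f₁ f₂ _ _ h₁ h₂ =>
    obtain ⟨C₁, hC₁, hb₁⟩ := h₁
    obtain ⟨C₂, hC₂, hb₂⟩ := h₂
    refine ⟨C₁ + C₂, by positivity, fun ξ hξ => ?_⟩
    rw [add_mul]
    exact (norm_add_le _ _).trans (add_le_add (hb₁ ξ hξ) (hb₂ ξ hξ))
  | smul a f _ h =>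
    obtain ⟨C, hC, hb⟩ := h
    refine ⟨‖a‖ * C, by positivity, fun ξ hξ => ?_⟩
    rw [Pi.smul_apply, norm_smul, mul_assoc]
    exact mul_le_mul_of_nonneg_left (hb ξ hξ) (norm_nonneg a)

theorem jap_rpow_neg_two_mul (r x : ℝ) : jap x ^ (-(2 * r)) = (1 + x ^ 2) ^ (-r) := by
  rw [jap, Real.sqrt_eq_rpow, ← Real.rpow_mul (by positivity)]
  ring_nf

theorem integral_rpow_mul_exp_neg_one_add_sq_mul {r : ℝ} (hr : 0 < r) (x : ℝ) :
    ∫ t in Ioi (0 : ℝ), t ^ (r - 1) * Real.exp (-((1 + x ^ 2) * t))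
      = (1 + x ^ 2) ^ (-r) * Real.Gamma r := by
  have hx : 0 < 1 + x ^ 2 := by positivity
  rw [Real.integral_rpow_mul_exp_neg_mul_Ioi hr hx, one_div, Real.inv_rpow hx.le,
    Real.rpow_neg hx.le]

theorem norm_exp_neg_I_mul_mul (x ξ : ℝ) : ‖Complex.exp (-(Complex.I * x * ξ))‖ = 1 := by
  rw [show -(Complex.I * x * ξ) = ((-(x * ξ) : ℝ) : ℂ) * Complex.I by push_cast; ring,
    Complex.norm_exp_ofReal_mul_I]

theorem integrable_exp_mul_rpow_mul_exp {r : ℝ} (hr : 1 / 2 < r) (ξ : ℝ) :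
    Integrable (Function.uncurry fun x t : ℝ => Complex.exp (-(Complex.I * x * ξ)) *
      ((t ^ (r - 1) * Real.exp (-((1 + x ^ 2) * t)) : ℝ) : ℂ))
      (volume.prod (volume.restrict (Ioi (0 : ℝ)))) := by
  have hm : Measurable (Function.uncurry fun x t : ℝ => Complex.exp (-(Complex.I * x * ξ)) *
      ((t ^ (r - 1) * Real.exp (-((1 + x ^ 2) * t)) : ℝ) : ℂ)) := by
    unfold Function.uncurry
    fun_prop
  refine (integrable_prod_iff hm.aestronglyMeasurable).mpr
    ⟨Filter.Eventually.of_forall fun x => ?_, ?_⟩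
  · have h : IntegrableOn (fun t : ℝ => t ^ (r - 1) * Real.exp (-((1 + x ^ 2) * t))) (Ioi 0) := by
      simpa only [neg_mul] using integrableOn_rpow_mul_exp_neg_mul (s := r - 1)
        (by linarith) (by positivity : 0 < 1 + x ^ 2)
    exact (Integrable.ofReal (𝕜 := ℂ) h).const_mul (Complex.exp (-(Complex.I * x * ξ)))
  · have h : ∀ x : ℝ, ∫ t in Ioi (0 : ℝ), ‖Function.uncurry (fun x t : ℝ =>
        Complex.exp (-(Complex.I * x * ξ)) *
          ((t ^ (r - 1) * Real.exp (-((1 + x ^ 2) * t)) : ℝ) : ℂ)) (x, t)‖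
        = (1 + x ^ 2) ^ (-r) * Real.Gamma r := fun x => by
      rw [← integral_rpow_mul_exp_neg_one_add_sq_mul (by linarith) x]
      refine setIntegral_congr_fun measurableSet_Ioi fun t (ht : 0 < t) => ?_
      simp only [Function.uncurry_apply_pair]
      rw [norm_mul, norm_exp_neg_I_mul_mul, one_mul, Complex.norm_real,
        Real.norm_of_nonneg (by positivity)]
    simp only [h]
    refine Integrable.mul_const ?_ _
    have := integrable_rpow_neg_one_add_norm_sq (E := ℝ) (μ := volume) (r := 2 * r)
      (by simp; linarith)
    simpa [neg_div, sq_abs] using this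

theorem integral_exp_neg_I_mul_exp_neg_mul_sq {t : ℝ} (ht : 0 < t) (ξ : ℝ) :
    ∫ x : ℝ, Complex.exp (-(Complex.I * x * ξ)) * Complex.exp (-t * x ^ 2)
      = ((Real.sqrt Real.pi * t ^ (-(1 / 2) : ℝ) * Real.exp (-(ξ ^ 2 / (4 * t))) : ℝ) : ℂ) := by
  have h := fourierIntegral_gaussian (b := t) (by simpa using ht) (-ξ)
  have e : ((Real.pi : ℂ) / t) ^ (1 / 2 : ℂ)
      = ((Real.sqrt Real.pi * t ^ (-(1 / 2) : ℝ) : ℝ) : ℂ) := by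
    have hc : ((Real.pi / t : ℝ) : ℂ) ^ ((1 / 2 : ℝ) : ℂ)
        = (((Real.pi / t) ^ (1 / 2 : ℝ) : ℝ) : ℂ) :=
      (Complex.ofReal_cpow (by positivity) _).symm
    rw [Real.sqrt_eq_rpow, Real.rpow_neg ht.le, ← div_eq_mul_inv,
      ← Real.div_rpow Real.pi_pos.le ht.le, ← hc]
    push_cast
    rfl
  rw [e] at h
  rw [Complex.ofReal_mul, Complex.ofReal_exp]
  convert h using 2
  · ext x
    ring_nf
  · push_cast
    ring_nf

theorem FT_jap_rpow {r : ℝ} (hr : 1 / 2 < r) (ξ : ℝ) :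
    FT (fun x => ((jap x ^ (-(2 * r)) : ℝ) : ℂ)) ξ
      = ((Real.sqrt Real.pi / Real.Gamma r * besselKernel (r - 1 / 2) ξ : ℝ) : ℂ) := by
  have hΓ : Real.Gamma r ≠ 0 := (Real.Gamma_pos_of_pos (by linarith)).ne'
  have hΓ' : (Real.Gamma r : ℂ) ≠ 0 := by exact_mod_cast hΓ
  have hleft : (Real.Gamma r : ℂ) * FT (fun x => ((jap x ^ (-(2 * r)) : ℝ) : ℂ)) ξ
      = ∫ x : ℝ, ∫ t in Ioi (0 : ℝ), Complex.exp (-(Complex.I * x * ξ)) *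
        ((t ^ (r - 1) * Real.exp (-((1 + x ^ 2) * t)) : ℝ) : ℂ) := by
    rw [FT, ← integral_const_mul]
    congr 1
    ext x
    rw [integral_const_mul, integral_complex_ofReal,
      integral_rpow_mul_exp_neg_one_add_sq_mul (by linarith), jap_rpow_neg_two_mul]
    push_cast
    ring
  have hinner : ∀ t ∈ Ioi (0 : ℝ), ∫ x : ℝ, Complex.exp (-(Complex.I * x * ξ)) *
        ((t ^ (r - 1) * Real.exp (-((1 + x ^ 2) * t)) : ℝ) : ℂ)
      = ((Real.sqrt Real.pi *
        (t ^ (r - 1 / 2 - 1) * Real.exp (-t - ξ ^ 2 / (4 * t))) : ℝ) : ℂ) := by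
    intro t (ht : 0 < t)
    have e : ∀ x : ℝ, Complex.exp (-(Complex.I * x * ξ)) *
        ((t ^ (r - 1) * Real.exp (-((1 + x ^ 2) * t)) : ℝ) : ℂ)
        = ((t ^ (r - 1) * Real.exp (-t) : ℝ) : ℂ) *
          (Complex.exp (-(Complex.I * x * ξ)) * Complex.exp (-t * x ^ 2)) := fun x => by
      rw [show -((1 + x ^ 2) * t) = -t + -t * x ^ 2 by ring, Real.exp_add]
      push_cast
      ring
    simp only [e]
    rw [integral_const_mul, integral_exp_neg_I_mul_exp_neg_mul_sq ht, ← Complex.ofReal_mul,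
      show r - 1 / 2 - 1 = (r - 1) + -(1 / 2) by ring, Real.rpow_add ht, sub_eq_add_neg (-t),
      Real.exp_add]
    congr 1
    ring
  have hmul : (Real.Gamma r : ℂ) * FT (fun x => ((jap x ^ (-(2 * r)) : ℝ) : ℂ)) ξ
      = ((Real.sqrt Real.pi * besselKernel (r - 1 / 2) ξ : ℝ) : ℂ) := by
    rw [hleft, integral_integral_swap (integrable_exp_mul_rpow_mul_exp hr ξ),
      setIntegral_congr_fun measurableSet_Ioi hinner, integral_complex_ofReal, integral_const_mul]
    rfl
  apply mul_left_cancel₀ hΓ'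
  rw [hmul, ← Complex.ofReal_mul]
  congr 1
  field_simp

/-- `h(ξ) = ∫ e^{-ixξ}⟨x⟩^{-2r} dx` is `C^∞` away from `0` and its derivatives
satisfy `|∂_ξ^β h(ξ)| ≤ C_{β,q} |ξ|^{-β} ⟨ξ⟩^{-q}`. -/
theorem stmt_6 (r : ℝ) (hr : 1 / 2 < r) :
    ContDiffOn ℝ (⊤ : ℕ∞) (FT (fun x => ((jap x ^ (-(2 * r)) : ℝ) : ℂ))) {ξ : ℝ | ξ ≠ 0} ∧
    ∀ (β : ℕ) (q : ℝ), 0 < q → ∃ C : ℝ, 0 < C ∧ ∀ ξ : ℝ, ξ ≠ 0 →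
      ‖iteratedDeriv β (FT (fun x => ((jap x ^ (-(2 * r)) : ℝ) : ℂ))) ξ‖
        ≤ C * |ξ| ^ (-(β : ℝ)) * jap ξ ^ (-q) := by
  have hs : 0 < r - 1 / 2 := by linarith
  have hf : ((Real.sqrt Real.pi / Real.Gamma r : ℝ) : ℂ) • besselTerm (r - 1 / 2) 0 0
      ∈ besselSpan (r - 1 / 2) 0 :=
    Submodule.smul_mem _ _ (Submodule.subset_span (mem_range_self 0))
  have heq : EqOn (FT (fun x => ((jap x ^ (-(2 * r)) : ℝ) : ℂ)))
      (((Real.sqrt Real.pi / Real.Gamma r : ℝ) : ℂ) • besselTerm (r - 1 / 2) 0 0)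
      {ξ | ξ ≠ 0} := fun ξ _ => by
    simp [FT_jap_rpow hr, besselTerm]
  refine ⟨contDiffOn_of_eqOn_besselSpan hf heq, fun β q _ => ?_⟩
  obtain ⟨g, hg, hβ⟩ := exists_iteratedDeriv_eqOn_besselSpan hf heq β
  obtain ⟨C₁, hC₁, h₁⟩ := exists_norm_le_of_mem_besselSpan hs hg
  obtain ⟨C₂, hC₂, h₂⟩ := exists_exp_neg_half_abs_le_jap_rpow q
  refine ⟨(C₁ + 1) * C₂, by positivity, fun ξ hξ => ?_⟩
  rw [hβ hξ]
  calc ‖g ξ‖ ≤ C₁ * (|ξ| ^ (-(β : ℝ)) * Real.exp (-(|ξ| / 2))) := h₁ ξ hξ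
    _ ≤ (C₁ + 1) * (|ξ| ^ (-(β : ℝ)) * (C₂ * jap ξ ^ (-q))) := by
      gcongr
      · linarith
      · exact h₂ ξ
    _ = (C₁ + 1) * C₂ * |ξ| ^ (-(β : ℝ)) * jap ξ ^ (-q) := by ring
end
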